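/- arXiv:1902.06439 — 4 statements merged into one kernel-verified Lean document; each statement's English description precedes it below -/
import Mathlib

section
/- Let ħ ∈ ℂ with ħ ≠ 0 and let U ⊆ ℂ be open. Let τ : ℂ → ℂ be analytic on U with τ(t) ≠ 0 for all t ∈ U, and define q : U → ℂ by q(t) = −ħ² · d/dt (τ′(t)/τ(t)). Then τ satisfies the Hirota bilinear form of Painlevé I, namely ħ⁴·(2·τ⁗(t)·τ(t) − 8·τ‴(t)·τ′(t) + 6·τ″(t)²) + 2·t·τ(t)² = 0 for all t ∈ U, if and only if q satisfies the first Painlevé equation ħ²·q″(t) = 6·q(t)² + t for all t ∈ U. -/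
/-- **Hirota bilinear form of Painlevé I.**
Let `hbar ≠ 0`, `U ⊆ ℂ` open, `τ` analytic and nonvanishing on `U`, and
`q t = -hbar² (d/dt)(τ'(t)/τ(t))`.  Then `τ` satisfies
`hbar⁴ (2 τ⁗ τ - 8 τ‴ τ' + 6 τ″²) + 2 t τ² = 0` on `U` iff `q` satisfies the
first Painlevé equation `hbar² q″ = 6 q² + t` on `U`. -/
theorem hirota_iff_painleveI (hbar : ℂ) (hhbar : hbar ≠ 0) (U : Set ℂ) (hU : IsOpen U)
    (τ : ℂ → ℂ) (hτ : AnalyticOnNhd ℂ τ U) (hτ0 : ∀ t ∈ U, τ t ≠ 0)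
    (q : ℂ → ℂ)
    (hq : ∀ t, q t = -hbar ^ 2 * deriv (fun s => deriv τ s / τ s) t) :
    (∀ t ∈ U,
      hbar ^ 4 * (2 * iteratedDeriv 4 τ t * τ t
        - 8 * iteratedDeriv 3 τ t * deriv τ t
        + 6 * (iteratedDeriv 2 τ t) ^ 2)
      + 2 * t * (τ t) ^ 2 = 0)
    ↔ (∀ t ∈ U, hbar ^ 2 * deriv (deriv q) t = 6 * q t ^ 2 + t) := by
  have e2 : iteratedDeriv 2 τ = deriv (deriv τ) := by
    simp [iteratedDeriv_succ, iteratedDeriv_zero]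
  have e3 : iteratedDeriv 3 τ = deriv (deriv (deriv τ)) := by
    rw [iteratedDeriv_succ, e2]
  have e4 : iteratedDeriv 4 τ = deriv (deriv (deriv (deriv τ))) := by
    rw [iteratedDeriv_succ, e3]
  rw [e2, e3, e4]
  have A1 := hτ.deriv
  have A2 := A1.deriv
  have A3 := A2.deriv
  have d0 : ∀ t ∈ U, HasDerivAt τ (deriv τ t) t :=
    fun t ht => (hτ t ht).differentiableAt.hasDerivAt
  have d1 : ∀ t ∈ U, HasDerivAt (deriv τ) (deriv (deriv τ) t) t :=
    fun t ht => (A1 t ht).differentiableAt.hasDerivAt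
  have d2 : ∀ t ∈ U, HasDerivAt (deriv (deriv τ)) (deriv (deriv (deriv τ)) t) t :=
    fun t ht => (A2 t ht).differentiableAt.hasDerivAt
  have d3 : ∀ t ∈ U, HasDerivAt (deriv (deriv (deriv τ)))
      (deriv (deriv (deriv (deriv τ))) t) t :=
    fun t ht => (A3 t ht).differentiableAt.hasDerivAt
  generalize deriv (deriv (deriv (deriv τ))) = e at *
  generalize deriv (deriv (deriv τ)) = d at *
  generalize deriv (deriv τ) = c at *
  generalize deriv τ = b at *
  have q0 : ∀ t ∈ U, q t = -hbar ^ 2 * (c t / τ t - b t ^ 2 / τ t ^ 2) := by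
    intro t ht
    have h0 := hτ0 t ht
    rw [hq, ((d1 t ht).fun_div (d0 t ht) h0).deriv]
    field_simp
  have q1 : ∀ t ∈ U, deriv q t = -hbar ^ 2 *
      (d t / τ t - 3 * (b t * c t) / τ t ^ 2 + 2 * b t ^ 3 / τ t ^ 3) := by
    intro t ht
    have h0 := hτ0 t ht
    have hE : q =ᶠ[nhds t] fun t => -hbar ^ 2 * (c t / τ t - b t ^ 2 / τ t ^ 2) :=
      Filter.eventuallyEq_of_mem (hU.mem_nhds ht) q0
    rw [hE.deriv_eq]
    have H := (((d2 t ht).fun_div (d0 t ht) h0).fun_sub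
      (((d1 t ht).fun_pow 2).fun_div ((d0 t ht).fun_pow 2) (pow_ne_zero 2 h0))).const_mul
      (-hbar ^ 2)
    rw [H.deriv]
    field_simp
    push_cast
    ring
  have q2 : ∀ t ∈ U, deriv (deriv q) t = -hbar ^ 2 *
      (e t / τ t - 4 * (b t * d t) / τ t ^ 2 - 3 * c t ^ 2 / τ t ^ 2
        + 12 * (b t ^ 2 * c t) / τ t ^ 3 - 6 * b t ^ 4 / τ t ^ 4) := by
    intro t ht
    have h0 := hτ0 t ht
    have hE : deriv q =ᶠ[nhds t] fun t => -hbar ^ 2 *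
      (d t / τ t - 3 * (b t * c t) / τ t ^ 2 + 2 * b t ^ 3 / τ t ^ 3) :=
      Filter.eventuallyEq_of_mem (hU.mem_nhds ht) q1
    rw [hE.deriv_eq]
    have H := ((((d3 t ht).fun_div (d0 t ht) h0).fun_sub
      ((((d1 t ht).fun_mul (d2 t ht)).const_mul 3).fun_div ((d0 t ht).fun_pow 2)
        (pow_ne_zero 2 h0))).fun_add
      ((((d1 t ht).fun_pow 3).const_mul 2).fun_div ((d0 t ht).fun_pow 3)
        (pow_ne_zero 3 h0))).const_mul (-hbar ^ 2)
    rw [H.deriv]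
    field_simp
    push_cast
    ring
  refine forall₂_congr fun t ht => ?_
  have h0 := hτ0 t ht
  rw [q2 t ht, q0 t ht]
  have key : hbar ^ 4 * (2 * e t * τ t - 8 * d t * b t + 6 * c t ^ 2) + 2 * t * τ t ^ 2
      = (-2 * τ t ^ 2) * (hbar ^ 2 * (-hbar ^ 2 *
      (e t / τ t - 4 * (b t * d t) / τ t ^ 2 - 3 * c t ^ 2 / τ t ^ 2
        + 12 * (b t ^ 2 * c t) / τ t ^ 3 - 6 * b t ^ 4 / τ t ^ 4))
      - (6 * (-hbar ^ 2 * (c t / τ t - b t ^ 2 / τ t ^ 2)) ^ 2 + t)) := by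
    field_simp
    ring
  rw [key, mul_eq_zero, sub_eq_zero]
  have : -2 * τ t ^ 2 ≠ 0 := mul_ne_zero (by norm_num) (pow_ne_zero 2 h0)
  simp only [this, false_or]
end

section
/- Let ħ ∈ ℂ with ħ ≠ 0. Let U ⊆ ℂ² be open, let Q, R : U → ℂ be analytic functions of (x,t), let H : ℂ → ℂ be differentiable in t, and set q(t) := −dH/dt(t). Suppose Ψ₊, Ψ₋ : U → ℂ are analytic functions each of which satisfies both equations ħ² ∂ₓ²Ψ − 2ħ·(R·ħ∂ₓΨ + Q·Ψ) − (4x³ + 2tx + 2H(t))·Ψ = 0 and ħ ∂ₜΨ − (R·ħ∂ₓΨ + Q·Ψ) = 0 on U, and suppose Wrˣ[Ψ₊,Ψ₋](x,t) ≠ 0 for all (x,t) ∈ U. Then on all of U the compatibility equations hold: 2·∂ₓQ − 2ħ·∂ₜR + 4ħ·R·∂ₓR + ħ·∂ₓ²R = 0, and 2·(4x³ + 2tx + 2H(t))·∂ₓR + 2·(6x² + t)·R − 2·(x − q(t)) − 2ħ·∂ₜQ + 4ħ·Q·∂ₓR + ħ·∂ₓ²Q = 0. -/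
/-- Partial derivative in the first (spectral, `x`) variable. -/
noncomputable def pdx (f : ℂ × ℂ → ℂ) : ℂ × ℂ → ℂ :=
  fun z => deriv (fun x => f (x, z.2)) z.1

/-- Partial derivative in the second (time, `t`) variable. -/
noncomputable def pdt (f : ℂ × ℂ → ℂ) : ℂ × ℂ → ℂ :=
  fun z => deriv (fun t => f (z.1, t)) z.2

theorem hdx {U : Set (ℂ × ℂ)} {f : ℂ × ℂ → ℂ} (hf : AnalyticOnNhd ℂ f U) {z : ℂ × ℂ}
    (hz : z ∈ U) : HasDerivAt (fun x => f (x, z.2)) (fderiv ℂ f z (1, 0)) z.1 := by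
  have h1 : HasFDerivAt f (fderiv ℂ f z) (z.1, z.2) := (hf z hz).differentiableAt.hasFDerivAt
  have h2 : HasDerivAt (fun x : ℂ => (x, z.2)) ((1 : ℂ), (0 : ℂ)) z.1 :=
    (hasDerivAt_id z.1).prodMk (hasDerivAt_const z.1 z.2)
  exact h1.comp_hasDerivAt z.1 h2

theorem hdt {U : Set (ℂ × ℂ)} {f : ℂ × ℂ → ℂ} (hf : AnalyticOnNhd ℂ f U) {z : ℂ × ℂ}
    (hz : z ∈ U) : HasDerivAt (fun t => f (z.1, t)) (fderiv ℂ f z (0, 1)) z.2 := by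
  have h1 : HasFDerivAt f (fderiv ℂ f z) (z.1, z.2) := (hf z hz).differentiableAt.hasFDerivAt
  have h2 : HasDerivAt (fun t : ℂ => (z.1, t)) ((0 : ℂ), (1 : ℂ)) z.2 :=
    (hasDerivAt_const z.2 z.1).prodMk (hasDerivAt_id z.2)
  exact h1.comp_hasDerivAt z.2 h2

theorem pdx_eq {U : Set (ℂ × ℂ)} {f : ℂ × ℂ → ℂ} (hf : AnalyticOnNhd ℂ f U) {z : ℂ × ℂ}
    (hz : z ∈ U) : pdx f z = fderiv ℂ f z (1, 0) := (hdx hf hz).deriv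

theorem pdt_eq {U : Set (ℂ × ℂ)} {f : ℂ × ℂ → ℂ} (hf : AnalyticOnNhd ℂ f U) {z : ℂ × ℂ}
    (hz : z ∈ U) : pdt f z = fderiv ℂ f z (0, 1) := (hdt hf hz).deriv

theorem hx {U : Set (ℂ × ℂ)} {f : ℂ × ℂ → ℂ} (hf : AnalyticOnNhd ℂ f U) {z : ℂ × ℂ}
    (hz : z ∈ U) : HasDerivAt (fun x => f (x, z.2)) (pdx f z) z.1 := by
  rw [pdx_eq hf hz]; exact hdx hf hz

theorem ht {U : Set (ℂ × ℂ)} {f : ℂ × ℂ → ℂ} (hf : AnalyticOnNhd ℂ f U) {z : ℂ × ℂ}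
    (hz : z ∈ U) : HasDerivAt (fun t => f (z.1, t)) (pdt f z) z.2 := by
  rw [pdt_eq hf hz]; exact hdt hf hz

theorem fd_an {U : Set (ℂ × ℂ)} {f : ℂ × ℂ → ℂ} (hf : AnalyticOnNhd ℂ f U) (v : ℂ × ℂ) :
    AnalyticOnNhd ℂ (fun z => fderiv ℂ f z v) U := fun z hz =>
  ((ContinuousLinearMap.apply ℂ ℂ v).analyticAt _).comp (hf.fderiv z hz)

theorem pdx_an {U : Set (ℂ × ℂ)} (hU : IsOpen U) {f : ℂ × ℂ → ℂ} (hf : AnalyticOnNhd ℂ f U) :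
    AnalyticOnNhd ℂ (pdx f) U :=
  (fd_an hf (1, 0)).congr hU (fun _ hz => (pdx_eq hf hz).symm)

theorem pdt_an {U : Set (ℂ × ℂ)} (hU : IsOpen U) {f : ℂ × ℂ → ℂ} (hf : AnalyticOnNhd ℂ f U) :
    AnalyticOnNhd ℂ (pdt f) U :=
  (fd_an hf (0, 1)).congr hU (fun _ hz => (pdt_eq hf hz).symm)

theorem evx {U : Set (ℂ × ℂ)} (hU : IsOpen U) {z : ℂ × ℂ} (hz : z ∈ U) :
    ∀ᶠ x in nhds z.1, (x, z.2) ∈ U := by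
  have : ContinuousAt (fun x : ℂ => (x, z.2)) z.1 := by fun_prop
  exact this.eventually_mem (hU.mem_nhds hz)

theorem evt {U : Set (ℂ × ℂ)} (hU : IsOpen U) {z : ℂ × ℂ} (hz : z ∈ U) :
    ∀ᶠ t in nhds z.2, (z.1, t) ∈ U := by
  have : ContinuousAt (fun t : ℂ => (z.1, t)) z.2 := by fun_prop
  exact this.eventually_mem (hU.mem_nhds hz)

theorem pdx_congr {U : Set (ℂ × ℂ)} (hU : IsOpen U) {f g : ℂ × ℂ → ℂ}
    (h : ∀ z ∈ U, f z = g z) {z : ℂ × ℂ} (hz : z ∈ U) : pdx f z = pdx g z := by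
  apply Filter.EventuallyEq.deriv_eq
  filter_upwards [evx hU hz] with x hx using h _ hx

theorem pdt_congr {U : Set (ℂ × ℂ)} (hU : IsOpen U) {f g : ℂ × ℂ → ℂ}
    (h : ∀ z ∈ U, f z = g z) {z : ℂ × ℂ} (hz : z ∈ U) : pdt f z = pdt g z := by
  apply Filter.EventuallyEq.deriv_eq
  filter_upwards [evt hU hz] with x hx using h _ hx

theorem zerox {U : Set (ℂ × ℂ)} (hU : IsOpen U) {F : ℂ × ℂ → ℂ}
    (h : ∀ z ∈ U, F z = 0) {z : ℂ × ℂ} (hz : z ∈ U) {d : ℂ}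
    (hd : HasDerivAt (fun x => F (x, z.2)) d z.1) : d = 0 := by
  have h1 : pdx F z = pdx (fun _ => 0) z := pdx_congr hU h hz
  have h2 : pdx F z = d := hd.deriv
  rw [← h2, h1]; simp [pdx]

theorem zerot {U : Set (ℂ × ℂ)} (hU : IsOpen U) {F : ℂ × ℂ → ℂ}
    (h : ∀ z ∈ U, F z = 0) {z : ℂ × ℂ} (hz : z ∈ U) {d : ℂ}
    (hd : HasDerivAt (fun t => F (z.1, t)) d z.2) : d = 0 := by
  have h1 : pdt F z = pdt (fun _ => 0) z := pdt_congr hU h hz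
  have h2 : pdt F z = d := hd.deriv
  rw [← h2, h1]; simp [pdt]

theorem pd_comm {U : Set (ℂ × ℂ)} (hU : IsOpen U) {f : ℂ × ℂ → ℂ}
    (hf : AnalyticOnNhd ℂ f U) {z : ℂ × ℂ} (hz : z ∈ U) : pdt (pdx f) z = pdx (pdt f) z := by
  have e1 : pdt (pdx f) z = pdt (fun z => fderiv ℂ f z (1, 0)) z :=
    pdt_congr hU (fun _ hw => pdx_eq hf hw) hz
  have e2 : pdx (pdt f) z = pdx (fun z => fderiv ℂ f z (0, 1)) z :=
    pdx_congr hU (fun _ hw => pdt_eq hf hw) hz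
  have hd : DifferentiableAt ℂ (fderiv ℂ f) z := (hf.fderiv z hz).differentiableAt
  have key : ∀ v w : ℂ × ℂ, fderiv ℂ (fun z => fderiv ℂ f z v) z w
      = fderiv ℂ (fderiv ℂ f) z w v := by
    intro v w
    rw [fderiv_clm_apply hd (differentiableAt_const v)]
    simp
  have hs : IsSymmSndFDerivAt ℂ f z := (hf z hz).contDiffAt.isSymmSndFDerivAt (n := ⊤) (by simp)
  rw [e1, e2, pdt_eq (fd_an hf _) hz, pdx_eq (fd_an hf _) hz, key, key]
  exact hs _ _

theorem one_sol (hbar : ℂ) (hhbar : hbar ≠ 0)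
    (U : Set (ℂ × ℂ)) (hU : IsOpen U)
    (Q R : ℂ × ℂ → ℂ) (hQ : AnalyticOnNhd ℂ Q U) (hR : AnalyticOnNhd ℂ R U)
    (H : ℂ → ℂ) (hH : Differentiable ℂ H)
    (P : ℂ × ℂ → ℂ) (hP : AnalyticOnNhd ℂ P U)
    (heq1 : ∀ z ∈ U,
      hbar ^ 2 * pdx (pdx P) z
        - 2 * hbar * (R z * (hbar * pdx P z) + Q z * P z)
        - (4 * z.1 ^ 3 + 2 * z.2 * z.1 + 2 * H z.2) * P z = 0)
    (heq2 : ∀ z ∈ U,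
      hbar * pdt P z - (R z * (hbar * pdx P z) + Q z * P z) = 0)
    (z : ℂ × ℂ) (hz : z ∈ U) :
    (2 * pdx Q z - 2 * hbar * pdt R z + 4 * hbar * R z * pdx R z
        + hbar * pdx (pdx R) z) * (hbar * pdx P z)
      + (2 * (4 * z.1 ^ 3 + 2 * z.2 * z.1 + 2 * H z.2) * pdx R z
        + 2 * (6 * z.1 ^ 2 + z.2) * R z - 2 * (z.1 + deriv H z.2)
        - 2 * hbar * pdt Q z + 4 * hbar * Q z * pdx R z
        + hbar * pdx (pdx Q) z) * P z = 0 := by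
  have hPx := pdx_an hU hP
  have hPxx := pdx_an hU hPx
  have hPt := pdt_an hU hP
  have hPtx := pdx_an hU hPt
  have hQx := pdx_an hU hQ
  have hRx := pdx_an hU hR
  have A : ∀ z ∈ U, hbar * pdx (pdt P) z - ((pdx R z * (hbar * pdx P z)
      + R z * (hbar * pdx (pdx P) z)) + (pdx Q z * P z + Q z * pdx P z)) = 0 := by
    intro z hz
    exact zerox hU heq2 hz (((hx hPt hz).const_mul hbar).sub
      (((hx hR hz).mul ((hx hPx hz).const_mul hbar)).add ((hx hQ hz).mul (hx hP hz))))
  have B := zerox hU A hz (((hx hPtx hz).const_mul hbar).sub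
      ((((hx hRx hz).mul ((hx hPx hz).const_mul hbar)).add
        ((hx hR hz).mul ((hx hPxx hz).const_mul hbar))).add
      (((hx hQx hz).mul (hx hP hz)).add ((hx hQ hz).mul (hx hPx hz)))))
  have Vx : HasDerivAt (fun x : ℂ => 4 * x ^ 3 + 2 * z.2 * x + 2 * H z.2)
      (12 * z.1 ^ 2 + 2 * z.2) z.1 := by
    have := ((((hasDerivAt_id z.1).pow 3).const_mul 4).add
      ((hasDerivAt_id z.1).const_mul (2 * z.2))).add (hasDerivAt_const z.1 (2 * H z.2))
    exact this.congr_deriv (by simp only [id, Nat.cast_ofNat]; norm_num; ring)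
  have Vt : HasDerivAt (fun t : ℂ => 4 * z.1 ^ 3 + 2 * t * z.1 + 2 * H t)
      (2 * z.1 + 2 * deriv H z.2) z.2 := by
    have := ((hasDerivAt_const z.2 (4 * z.1 ^ 3)).add
      (((hasDerivAt_id z.2).const_mul 2).mul_const z.1)).add
        ((hH z.2).hasDerivAt.const_mul 2)
    exact this.congr_deriv (by norm_num)
  have C := zerox hU heq1 hz ((((hx hPxx hz).const_mul (hbar ^ 2)).sub
      ((((hx hR hz).mul ((hx hPx hz).const_mul hbar)).add
        ((hx hQ hz).mul (hx hP hz))).const_mul (2 * hbar))).sub (Vx.mul (hx hP hz)))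
  have D := zerot hU heq1 hz ((((ht hPxx hz).const_mul (hbar ^ 2)).sub
      ((((ht hR hz).mul ((ht hPx hz).const_mul hbar)).add
        ((ht hQ hz).mul (ht hP hz))).const_mul (2 * hbar))).sub (Vt.mul (ht hP hz)))
  have s1 : pdt (pdx P) z = pdx (pdt P) z := pd_comm hU hP hz
  have s2 : pdt (pdx (pdx P)) z = pdx (pdx (pdt P)) z :=
    (pd_comm hU hPx hz).trans (pdx_congr hU (fun _ hw => pd_comm hU hP hw) hz)
  have A0 := A z hz
  have h1 := heq1 z hz
  have h2 := heq2 z hz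
  rw [s1, s2] at D
  apply mul_left_cancel₀ hhbar
  linear_combination hbar * (D - hbar * B) - hbar * R z * C + 2 * R z * hbar ^ 2 * A0
    - (2 * pdx R z * hbar + Q z) * h1
    + (2 * Q z * hbar + (4 * z.1 ^ 3 + 2 * z.2 * z.1 + 2 * H z.2)) * h2

/-- **Compatibility (zero-curvature) equations.**
If two analytic solutions `Ψ₊, Ψ₋` of the system
`hbar² ∂ₓ²Ψ - 2 hbar (R hbar ∂ₓΨ + Q Ψ) - (4x³ + 2tx + 2H(t)) Ψ = 0`,
`hbar ∂ₜΨ - (R hbar ∂ₓΨ + Q Ψ) = 0`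
have a nonvanishing `x`-Wronskian on `U`, then the compatibility equations for
`Q` and `R` hold on `U` (with `q = -H'`). -/
theorem compatibility_equations (hbar : ℂ) (hhbar : hbar ≠ 0)
    (U : Set (ℂ × ℂ)) (hU : IsOpen U)
    (Q R : ℂ × ℂ → ℂ) (hQ : AnalyticOnNhd ℂ Q U) (hR : AnalyticOnNhd ℂ R U)
    (H : ℂ → ℂ) (hH : Differentiable ℂ H)
    (q : ℂ → ℂ) (hq : ∀ t, q t = -deriv H t)
    (Ψp Ψm : ℂ × ℂ → ℂ)
    (hΨp : AnalyticOnNhd ℂ Ψp U) (hΨm : AnalyticOnNhd ℂ Ψm U)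
    (heq1p : ∀ z ∈ U,
      hbar ^ 2 * pdx (pdx Ψp) z
        - 2 * hbar * (R z * (hbar * pdx Ψp z) + Q z * Ψp z)
        - (4 * z.1 ^ 3 + 2 * z.2 * z.1 + 2 * H z.2) * Ψp z = 0)
    (heq1m : ∀ z ∈ U,
      hbar ^ 2 * pdx (pdx Ψm) z
        - 2 * hbar * (R z * (hbar * pdx Ψm z) + Q z * Ψm z)
        - (4 * z.1 ^ 3 + 2 * z.2 * z.1 + 2 * H z.2) * Ψm z = 0)
    (heq2p : ∀ z ∈ U,
      hbar * pdt Ψp z - (R z * (hbar * pdx Ψp z) + Q z * Ψp z) = 0)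
    (heq2m : ∀ z ∈ U,
      hbar * pdt Ψm z - (R z * (hbar * pdx Ψm z) + Q z * Ψm z) = 0)
    (hWr : ∀ z ∈ U,
      hbar * pdx Ψp z * Ψm z - Ψp z * (hbar * pdx Ψm z) ≠ 0) :
    ∀ z ∈ U,
      (2 * pdx Q z - 2 * hbar * pdt R z + 4 * hbar * R z * pdx R z
        + hbar * pdx (pdx R) z = 0)
      ∧ (2 * (4 * z.1 ^ 3 + 2 * z.2 * z.1 + 2 * H z.2) * pdx R z
        + 2 * (6 * z.1 ^ 2 + z.2) * R z - 2 * (z.1 - q z.2)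
        - 2 * hbar * pdt Q z + 4 * hbar * Q z * pdx R z
        + hbar * pdx (pdx Q) z = 0) := by
  intro z hz
  have ep := one_sol hbar hhbar U hU Q R hQ hR H hH Ψp hΨp heq1p heq2p z hz
  have em := one_sol hbar hhbar U hU Q R hQ hR H hH Ψm hΨm heq1m heq2m z hz
  have hW := hWr z hz
  rw [hq]
  constructor
  · apply mul_left_cancel₀ hW
    linear_combination Ψm z * ep - Ψp z * em
  · apply mul_left_cancel₀ hW
    linear_combination hbar * pdx Ψp z * em - hbar * pdx Ψm z * ep
end

section
/- Let ν, ρ ∈ ℂ and ħ ∈ ℂ with ħ ≠ 0, and define the Stokes multipliers s₋₂ = i·(e^{−2πiρ/ħ} − e^{2πi(ν−ρ)/ħ}), s₋₁ = i·(−e^{−2πi(ν−ρ)/ħ} + e^{−2πiν/ħ}), s₀ = i·e^{2πiν/ħ}, s₁ = i·(e^{−2πiν/ħ} − e^{−2πi(ν+ρ)/ħ} + e^{−2πiρ/ħ}), s₂ = i·e^{2πiρ/ħ}. Then the cyclic relation holds as an identity of 2×2 complex matrices: [[1,0],[s₂,1]] · [[1,s₁],[0,1]] · [[1,0],[s₀,1]]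 · [[1,s₋₁],[0,1]] · [[1,0],[s₋₂,1]] = [[0,i],[i,0]]. -/
open Complex

/-- **Cyclic relation for the Stokes multipliers of Painlevé I.**
With the Stokes multipliers `s₋₂, …, s₂` expressed in the parameters `ν, ρ`
of the 2-parameter τ-function, the cyclic relation holds as an identity of
`2×2` complex matrices. -/
theorem stokes_cyclic_relation (ν ρ hbar : ℂ) (hhbar : hbar ≠ 0)
    (sm2 sm1 s0 s1 s2 : ℂ)
    (hsm2 : sm2 = I * (exp (-2 * Real.pi * I * ρ / hbar)
      - exp (2 * Real.pi * I * (ν - ρ) / hbar)))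
    (hsm1 : sm1 = I * (-exp (-2 * Real.pi * I * (ν - ρ) / hbar)
      + exp (-2 * Real.pi * I * ν / hbar)))
    (hs0 : s0 = I * exp (2 * Real.pi * I * ν / hbar))
    (hs1 : s1 = I * (exp (-2 * Real.pi * I * ν / hbar)
      - exp (-2 * Real.pi * I * (ν + ρ) / hbar)
      + exp (-2 * Real.pi * I * ρ / hbar)))
    (hs2 : s2 = I * exp (2 * Real.pi * I * ρ / hbar)) :
    !![(1 : ℂ), 0; s2, 1] * !![(1 : ℂ), s1; 0, 1] * !![(1 : ℂ), 0; s0, 1]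
      * !![(1 : ℂ), sm1; 0, 1] * !![(1 : ℂ), 0; sm2, 1]
    = !![(0 : ℂ), I; I, 0] := by
  have e1 : exp (-2 * Real.pi * I * ρ / hbar) = (exp (2 * Real.pi * I * ρ / hbar))⁻¹ := by
    rw [← Complex.exp_neg]; congr 1; ring
  have e2 : exp (-2 * Real.pi * I * ν / hbar) = (exp (2 * Real.pi * I * ν / hbar))⁻¹ := by
    rw [← Complex.exp_neg]; congr 1; ring
  have e3 : exp (2 * Real.pi * I * (ν - ρ) / hbar)
      = exp (2 * Real.pi * I * ν / hbar) * (exp (2 * Real.pi * I * ρ / hbar))⁻¹ := by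
    rw [← Complex.exp_neg, ← Complex.exp_add]; congr 1; ring
  have e4 : exp (-2 * Real.pi * I * (ν - ρ) / hbar)
      = (exp (2 * Real.pi * I * ν / hbar))⁻¹ * exp (2 * Real.pi * I * ρ / hbar) := by
    rw [← Complex.exp_neg, ← Complex.exp_add]; congr 1; ring
  have e5 : exp (-2 * Real.pi * I * (ν + ρ) / hbar)
      = (exp (2 * Real.pi * I * ν / hbar))⁻¹ * (exp (2 * Real.pi * I * ρ / hbar))⁻¹ := by
    rw [← Complex.exp_neg, ← Complex.exp_neg, ← Complex.exp_add]; congr 1; ring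
  rw [e1, e3] at hsm2
  rw [e4, e2] at hsm1
  rw [e2, e5, e1] at hs1
  have ha := Complex.exp_ne_zero (2 * Real.pi * I * ν / hbar)
  have hb := Complex.exp_ne_zero (2 * Real.pi * I * ρ / hbar)
  clear e1 e2 e3 e4 e5
  generalize exp (2 * Real.pi * I * ν / hbar) = a at *
  generalize exp (2 * Real.pi * I * ρ / hbar) = b at *
  have hA : a * a⁻¹ = 1 := mul_inv_cancel₀ ha
  have hB : b * b⁻¹ = 1 := mul_inv_cancel₀ hb
  generalize a⁻¹ = A at *
  generalize b⁻¹ = B at *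
  have hI : I * I = -1 := Complex.I_mul_I
  have r1 : 1 + s0 * s1 = -I * sm2 := by subst_vars; grind
  have r2 : 1 + s1 * s2 = -I * sm1 := by subst_vars; grind
  have r3 : 1 + sm1 * s0 = -I * s2 := by subst_vars; grind
  have r4 : 1 + s2 * sm2 = -I * s0 := by subst_vars; grind
  have r5 : 1 + sm2 * sm1 = -I * s1 := by subst_vars; grind
  clear hsm2 hsm1 hs0 hs1 hs2
  ext i j
  fin_cases i <;> fin_cases j <;> simp [Matrix.mul_apply, Fin.sum_univ_two] <;> grind
end

section
/- Let ν, ρ ∈ ℂ and ħ ∈ ℂ with ħ ≠ 0, and let s : ℤ → ℂ be the 5-periodic sequence (s_{ℓ+5} = s_ℓ for all ℓ) determined by s₋₂ = i·(e^{−2πiρ/ħ} − e^{2πi(ν−ρ)/ħ}), s₋₁ = i·(−e^{−2πi(ν−ρ)/ħ} + e^{−2πiν/ħ}), s₀ = i·e^{2πiν/ħ}, s₁ = i·(e^{−2πiν/ħ} − e^{−2πi(ν+ρ)/ħ} + e^{−2πiρ/ħ}), s₂ = i·e^{2πiρ/ħ}. Then for every ℓ ∈ ℤ one has 1 + s_{ℓ−1}·s_ℓ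 + i·s_{ℓ+2} = 0. -/
open Complex

/-- **Cluster exchange relations for the Stokes multipliers of Painlevé I.**
Let `s : ℤ → ℂ` be the `5`-periodic sequence determined by the Stokes
multipliers `s₋₂, …, s₂` of Painlevé I.  Then for every `ℓ ∈ ℤ`,
`1 + s_{ℓ-1} s_ℓ + i s_{ℓ+2} = 0`. -/
theorem stokes_exchange_relation (ν ρ hbar : ℂ) (hhbar : hbar ≠ 0)
    (s : ℤ → ℂ)
    (hper : ∀ ℓ : ℤ, s (ℓ + 5) = s ℓ)
    (hsm2 : s (-2) = I * (exp (-2 * Real.pi * I * ρ / hbar)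
      - exp (2 * Real.pi * I * (ν - ρ) / hbar)))
    (hsm1 : s (-1) = I * (-exp (-2 * Real.pi * I * (ν - ρ) / hbar)
      + exp (-2 * Real.pi * I * ν / hbar)))
    (hs0 : s 0 = I * exp (2 * Real.pi * I * ν / hbar))
    (hs1 : s 1 = I * (exp (-2 * Real.pi * I * ν / hbar)
      - exp (-2 * Real.pi * I * (ν + ρ) / hbar)
      + exp (-2 * Real.pi * I * ρ / hbar)))
    (hs2 : s 2 = I * exp (2 * Real.pi * I * ρ / hbar)) :
    ∀ ℓ : ℤ, 1 + s (ℓ - 1) * s ℓ + I * s (ℓ + 2) = 0 := by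
  have hP : Function.Periodic s 5 := hper
  obtain ⟨a, ha⟩ : ∃ a, a = exp (2 * Real.pi * I * ν / hbar) := ⟨_, rfl⟩
  obtain ⟨b, hb⟩ : ∃ b, b = exp (2 * Real.pi * I * ρ / hbar) := ⟨_, rfl⟩
  have ha0 : a ≠ 0 := by rw [ha]; exact exp_ne_zero _
  have hb0 : b ≠ 0 := by rw [hb]; exact exp_ne_zero _
  have e1 : exp (-2 * Real.pi * I * ρ / hbar) = b⁻¹ := by
    rw [hb, ← exp_neg]; congr 1; ring
  have e2 : exp (-2 * Real.pi * I * ν / hbar) = a⁻¹ := by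
    rw [ha, ← exp_neg]; congr 1; ring
  have e3 : exp (2 * Real.pi * I * (ν - ρ) / hbar) = a * b⁻¹ := by
    rw [ha, hb, ← exp_neg, ← exp_add]; congr 1; ring
  have e4 : exp (-2 * Real.pi * I * (ν - ρ) / hbar) = a⁻¹ * b := by
    rw [ha, hb, ← exp_neg, ← exp_add]; congr 1; ring
  have e5 : exp (-2 * Real.pi * I * (ν + ρ) / hbar) = a⁻¹ * b⁻¹ := by
    rw [ha, hb, ← exp_neg, ← exp_neg, ← exp_add]; congr 1; ring
  rw [e1, e3] at hsm2
  rw [e4, e2] at hsm1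
  rw [← ha] at hs0
  rw [e1, e2, e5] at hs1
  rw [← hb] at hs2
  have h3 : s 3 = s (-2) := by have := hper (-2); norm_num at this; exact this
  have h4 : s 4 = s (-1) := by have := hper (-1); norm_num at this; exact this
  have h5 : s 5 = s 0 := hper 0
  have h6 : s 6 = s 1 := hper 1
  have hI : I * I = -1 := I_mul_I
  have haa : a * a⁻¹ = 1 := mul_inv_cancel₀ ha0
  have hbb : b * b⁻¹ = 1 := mul_inv_cancel₀ hb0
  generalize a⁻¹ = A at *
  generalize b⁻¹ = B at *
  have key : ∀ r : ℤ, 0 ≤ r → r < 5 → 1 + s (r - 1) * s r + I * s (r + 2) = 0 := by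
    intro r h0 h1
    interval_cases r <;> norm_num [h3, h4, h5, h6, hsm2, hsm1, hs0, hs1, hs2] <;> grind
  intro ℓ
  have hs : ∀ c : ℤ, s (ℓ + c) = s (ℓ % 5 + c) := by
    intro c
    have := hP.int_mul (ℓ / 5) (ℓ % 5 + c)
    rw [← this]
    congr 1
    have := Int.emod_add_mul_ediv ℓ 5
    simp only [Int.cast_id]
    linarith
  have k := key (ℓ % 5) (by omega) (by omega)
  have q1 := hs (-1)
  have q2 := hs 0
  have q3 := hs 2
  simp only [add_zero, ← sub_eq_add_neg] at q1 q2 q3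
  rw [q1, q2, q3]
  exact k
end
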